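/- Let K ⊆ L be a nonempty finite language controllable with respect to the plant language L, and suppose there exists an uncontrollable event u ∈ Σ_uc with the one-letter string [u] ∈ L. Then every minimal nonempty controllable sublanguage K' ⊆ K with respect to L contains only strings whose first event is uncontrollable; in particular K' contains no string beginning with a controllable event. -/

import Mathlib

/-- Prefix closure of a language: all strings that can be extended to a member. -/
def pref {α : Type*} (K : Set (List α)) : Set (List α) := {s | ∃ t, s ++ t ∈ K}

/-- A language `K` is controllable w.r.t. the plant language `L` (with uncontrollable
events `Suc`) if `pref(K)·Suc ∩ L ⊆ pref(K)`. -/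
def Controllable {α : Type*} (Suc : Set α) (L K : Set (List α)) : Prop :=
  ∀ s ∈ pref K, ∀ u ∈ Suc, s ++ [u] ∈ L → s ++ [u] ∈ pref K

/-- A language is prefix-closed. -/
def PrefixClosed {α : Type*} (L : Set (List α)) : Prop :=
  ∀ s ∈ L, ∀ t : List α, t <+: s → t ∈ L
/-- `K1` is a minimal nonempty controllable sublanguage of `K` with respect to the
plant `L`. -/
def IsMinCtrlSub {α : Type*} (Suc : Set α) (L K K1 : Set (List α)) : Prop :=
  K1 ⊆ K ∧ K1.Nonempty ∧ Controllable Suc L K1 ∧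
  ∀ K2 : Set (List α), K2 ⊆ K → K2.Nonempty → Controllable Suc L K2 → K2 ⊆ K1 → K2 = K1

/-- Keeping only the strings of a controllable language that start with an uncontrollable event
preserves controllability. -/
theorem Controllable.sep_uncontrollable_head {α : Type*} {Suc : Set α} {L K : Set (List α)}
    (hK : Controllable Suc L K) :
    Controllable Suc L {s ∈ K | ∃ u ∈ Suc, ∃ t : List α, s = u :: t} := by
  rintro s ⟨t, htK, u, hu, r, hr⟩ v hv hsv
  obtain ⟨w, hw⟩ := hK s ⟨t, htK⟩ v hv hsv
  refine ⟨w, hw, ?_⟩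
  cases s with
  | nil => exact ⟨v, hv, w, rfl⟩
  | cons a s =>
    obtain ⟨rfl, -⟩ := List.cons.inj hr
    exact ⟨a, hu, s ++ [v] ++ w, rfl⟩

/-- A nonempty controllable language contains a string starting with any uncontrollable event that
the plant can execute initially. -/
theorem Controllable.exists_cons_mem {α : Type*} {Suc : Set α} {L K : Set (List α)}
    (hK : Controllable Suc L K) (hne : K.Nonempty) {u : α} (hu : u ∈ Suc) (huL : [u] ∈ L) :
    ∃ t : List α, u :: t ∈ K := by
  obtain ⟨s, hs⟩ := hne
  exact hK [] ⟨s, hs⟩ u hu huL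

/-- If some uncontrollable event `u` satisfies `[u] ∈ L`, then every
minimal nonempty controllable sublanguage `K'` of `K` contains only strings whose
first event is uncontrollable; in particular no string of `K'` begins with a
controllable event. -/
theorem minimal_sublanguage_starts_uncontrollable {α : Type*} [Fintype α] (Sc Suc : Set α)
    (hpart : Sc ∪ Suc = Set.univ) (hdisj : Disjoint Sc Suc)
    (L : Set (List α)) (hL : PrefixClosed L)
    (K : Set (List α)) (hKL : K ⊆ L) (hKne : K.Nonempty) (hKfin : K.Finite)
    (hKc : Controllable Suc L K)
    (u : α) (hu : u ∈ Suc) (huL : [u] ∈ L) :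
    ∀ K' : Set (List α), IsMinCtrlSub Suc L K K' →
      (∀ s ∈ K', ∃ u' ∈ Suc, ∃ t : List α, s = u' :: t) ∧
      (∀ s ∈ K', ∀ a ∈ Sc, ∀ t : List α, s ≠ a :: t) := by
  rintro K' ⟨hK'K, hne, hctrl, hmin⟩
  obtain ⟨t, ht⟩ := hctrl.exists_cons_mem hne hu huL
  have heq := hmin {s ∈ K' | ∃ u' ∈ Suc, ∃ t : List α, s = u' :: t}
    ((Set.sep_subset _ _).trans hK'K) ⟨u :: t, ht, u, hu, t, rfl⟩
    hctrl.sep_uncontrollable_head (Set.sep_subset _ _)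
  have hhead : ∀ s ∈ K', ∃ u' ∈ Suc, ∃ t : List α, s = u' :: t :=
    fun s hs => (heq.symm.subset hs).2
  refine ⟨hhead, ?_⟩
  rintro s hs a ha r rfl
  obtain ⟨v, hv, w, hvw⟩ := hhead _ hs
  obtain ⟨rfl, -⟩ := List.cons.inj hvw
  exact Set.disjoint_left.mp hdisj ha hv
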